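/- Let φ:(R,m)→(S,n) be a flat local homomorphism of Noetherian local rings of prime characteristic p such that the closed fiber S/mS is Gorenstein. Assume that R is weakly F-regular and Cohen–Macaulay, that some c ∈ S − mS is a test element for S, and that S/mS is F-rational. Then S is weakly F-regular. -/

import Mathlib

open IsLocalRing

/-- The Frobenius power `I^[q]` of an ideal: the ideal generated by the `q`-th powers
of the elements of `I`. -/
def Ideal.frobPow {R : Type*} [CommRing R] (I : Ideal R) (q : ℕ) : Ideal R :=
  Ideal.span ((fun x : R => x ^ q) '' (I : Set R))

/-- `R°`: the complement in `R` of the union of the minimal primes of `R`. -/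
def circComplement (R : Type*) [CommRing R] : Set R :=
  {c : R | ∀ P ∈ minimalPrimes R, c ∉ P}

/-- `x ∈ I*`: tight closure membership (`p` is the characteristic). -/
def MemTightClosure {R : Type*} [CommRing R] (p : ℕ) (I : Ideal R) (x : R) : Prop :=
  ∃ c ∈ circComplement R, ∃ N : ℕ, ∀ e : ℕ, N ≤ e → c * x ^ p ^ e ∈ I.frobPow (p ^ e)

/-- An ideal is tightly closed if `I* = I`. -/
def Ideal.IsTightlyClosed {R : Type*} [CommRing R] (p : ℕ) (I : Ideal R) : Prop :=
  ∀ x : R, MemTightClosure p I x → x ∈ I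

/-- An ideal is Frobenius closed if `x^q ∈ I^[q]` for some `q` implies `x ∈ I`. -/
def Ideal.IsFrobeniusClosed {R : Type*} [CommRing R] (p : ℕ) (I : Ideal R) : Prop :=
  ∀ x : R, (∃ e : ℕ, x ^ p ^ e ∈ I.frobPow (p ^ e)) → x ∈ I

/-- A ring is weakly F-regular if every ideal is tightly closed. -/
def IsWeaklyFRegular (R : Type*) [CommRing R] (p : ℕ) : Prop :=
  ∀ I : Ideal R, I.IsTightlyClosed p

/-- A test element: an element of `R°` that works in every tight closure test. -/
def IsTestElement {R : Type*} [CommRing R] (p : ℕ) (c : R) : Prop :=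
  c ∈ circComplement R ∧
    ∀ (I : Ideal R) (x : R), MemTightClosure p I x → ∀ e : ℕ, c * x ^ p ^ e ∈ I.frobPow (p ^ e)

/-- A (full) system of parameters of a local ring: `dim R` elements of the maximal
ideal generating an ideal whose radical is the maximal ideal. -/
def IsSystemOfParameters (R : Type*) [CommRing R] [IsLocalRing R] {n : ℕ} (x : Fin n → R) : Prop :=
  ringKrullDim R = n ∧ (∀ i, x i ∈ maximalIdeal R) ∧
    maximalIdeal R ≤ (Ideal.span (Set.range x)).radical

/-- A parameter ideal: an ideal generated by part of a system of parameters. -/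
def Ideal.IsParameterIdeal {R : Type*} [CommRing R] [IsLocalRing R] (I : Ideal R) : Prop :=
  ∃ (n k : ℕ) (h : k ≤ n) (x : Fin n → R), IsSystemOfParameters R x ∧
    I = Ideal.span (Set.range fun i : Fin k => x (Fin.castLE h i))

/-- A local ring is F-rational if every parameter ideal is tightly closed. -/
def IsFRational (R : Type*) [CommRing R] [IsLocalRing R] (p : ℕ) : Prop :=
  ∀ I : Ideal R, I.IsParameterIdeal → I.IsTightlyClosed p

/-- A local ring is F-injective if every parameter ideal is Frobenius closed. -/
def IsFInjective (R : Type*) [CommRing R] [IsLocalRing R] (p : ℕ) : Prop :=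
  ∀ I : Ideal R, I.IsParameterIdeal → I.IsFrobeniusClosed p

/-- A local ring is Cohen-Macaulay if some system of parameters is a regular sequence. -/
def IsCohenMacaulayLocalRing (R : Type*) [CommRing R] [IsLocalRing R] : Prop :=
  ∃ (n : ℕ) (x : Fin n → R), IsSystemOfParameters R x ∧
    RingTheory.Sequence.IsRegular R (List.ofFn x)

/-- An irreducible ideal: a proper ideal that is not the intersection of two
strictly larger ideals. -/
def Ideal.IsIrreducible {R : Type*} [CommRing R] (I : Ideal R) : Prop :=
  I ≠ ⊤ ∧ ∀ A B : Ideal R, I = A ⊓ B → I = A ∨ I = B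

/-- A local ring is Gorenstein if it is Cohen-Macaulay and some system of parameters
generates an irreducible ideal. -/
def IsGorensteinLocalRing (R : Type*) [CommRing R] [IsLocalRing R] : Prop :=
  ∃ (n : ℕ) (x : Fin n → R), IsSystemOfParameters R x ∧
    RingTheory.Sequence.IsRegular R (List.ofFn x) ∧
    (Ideal.span (Set.range x)).IsIrreducible

section SocleGenerator

variable {A : Type*} [CommRing A]

/-- `w ∉ J` and `w` lies in every ideal strictly larger than `J`. -/
def Ideal.IsSocleGenerator (J : Ideal A) (w : A) : Prop :=
  w ∉ J ∧ ∀ s ∉ J, ∃ a, w - a * s ∈ J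

theorem Ideal.mem_sup_span_singleton_iff {J : Ideal A} {x y : A} :
    x ∈ J ⊔ Ideal.span {y} ↔ ∃ a, x - a * y ∈ J := by
  rw [sup_comm, Ideal.mem_span_singleton_sup]
  constructor
  · rintro ⟨a, b, hb, rfl⟩
    exact ⟨a, by simpa using hb⟩
  · rintro ⟨a, ha⟩
    exact ⟨a, _, ha, by ring⟩

theorem Ideal.exists_notMem_forall_mul_mem {K K' n : Ideal A} (hlt : ¬ K' ≤ K) {M : ℕ}
    (hM : n ^ M ≤ K) : ∃ s ∈ K', s ∉ K ∧ ∀ a ∈ n, a * s ∈ K := by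
  replace hM : n ^ M * K' ≤ K := Ideal.mul_le_left.trans hM
  induction M with
  | zero => exact absurd (by simpa using hM) hlt
  | succ M ih =>
    by_cases h : n ^ M * K' ≤ K
    · exact ih h
    · obtain ⟨s, hs, hsK⟩ := SetLike.not_le_iff_exists.mp h
      refine ⟨s, Ideal.mul_le_right hs, hsK, fun a ha => hM ?_⟩
      rw [pow_succ', mul_assoc]
      exact Ideal.mul_mem_mul ha hs

theorem Ideal.IsSocleGenerator.le_of_notMem {J K : Ideal A} {w : A}
    (h : J.IsSocleGenerator w) (hK : J ≤ K) (hw : w ∉ K) : K ≤ J := by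
  intro s hs
  by_contra hsJ
  obtain ⟨a, ha⟩ := h.2 s hsJ
  exact hw ((Submodule.sub_mem_iff_left K (K.mul_mem_left a hs)).mp (hK ha))

variable [IsLocalRing A]

theorem Ideal.mem_of_sub_mul_mem {J : Ideal A} {w b : A} (hb : b ∈ maximalIdeal A)
    (h : w - b * w ∈ J) : w ∈ J := by
  have hu : IsUnit (1 - b) := (IsLocalRing.isUnit_or_isUnit_one_sub_self b).resolve_left hb
  rw [← Ideal.unit_mul_mem_iff_mem J hu]
  convert h using 1; ring

theorem Ideal.IsSocleGenerator.mul_mem {J : Ideal A} {w : A} (h : J.IsSocleGenerator w) {b : A}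
    (hb : b ∈ maximalIdeal A) : b * w ∈ J := by
  by_contra hbw
  obtain ⟨a, ha⟩ := h.2 _ hbw
  exact h.1 (Ideal.mem_of_sub_mul_mem (Ideal.mul_mem_left _ a hb) (by rwa [mul_assoc]))

theorem Ideal.IsIrreducible.exists_isSocleGenerator {I : Ideal A} (hI : I.IsIrreducible) {N : ℕ}
    (hN : maximalIdeal A ^ N ≤ I) : ∃ u, I.IsSocleGenerator u := by
  obtain ⟨u, -, huI, hu⟩ := Ideal.exists_notMem_forall_mul_mem
    (fun h => hI.1 (top_le_iff.mp h)) hN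
  refine ⟨u, huI, fun s hs => ?_⟩
  obtain ⟨t, hts, htI, ht⟩ := Ideal.exists_notMem_forall_mul_mem
    (K' := Ideal.span {s}) (by simpa [Ideal.span_singleton_le_iff_mem] using hs) hN
  obtain ⟨d, rfl⟩ := Ideal.mem_span_singleton'.mp hts
  suffices u ∈ I ⊔ Ideal.span {d * s} by
    obtain ⟨a, ha⟩ := Ideal.mem_sup_span_singleton_iff.mp this
    exact ⟨a * d, by rwa [mul_assoc]⟩
  by_contra hcon
  have hinf : I = (I ⊔ Ideal.span {u}) ⊓ (I ⊔ Ideal.span {d * s}) := by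
    refine le_antisymm (le_inf le_sup_left le_sup_left) ?_
    rintro y ⟨hy1, hy2⟩
    obtain ⟨a, ha⟩ := Ideal.mem_sup_span_singleton_iff.mp hy1
    have hau : a * u ∈ I ⊔ Ideal.span {d * s} := by
      have := sub_mem hy2 (Ideal.mem_sup_left (T := Ideal.span {d * s}) ha)
      simpa using this
    have ha' : a ∈ maximalIdeal A := fun hunit =>
      hcon ((Ideal.unit_mul_mem_iff_mem _ hunit).mp hau)
    simpa using add_mem ha (hu a ha')
  rcases hI.2 _ _ hinf with h | h
  · exact huI (h ▸ Ideal.mem_sup_right (Ideal.mem_span_singleton_self u))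
  · exact htI (h ▸ Ideal.mem_sup_right (Ideal.mem_span_singleton_self (d * s)))

theorem Ideal.coheight_le_coheight_sup_span_singleton_add_one (K : Ideal A) {s : A}
    (hs : ∀ a ∈ maximalIdeal A, a * s ∈ K) :
    Order.coheight K ≤ Order.coheight (K ⊔ Ideal.span {s}) + 1 := by
  let f : A →ₗ[A] A ⧸ K := LinearMap.toSpanSingleton A (A ⧸ K) (Submodule.Quotient.mk s)
  have hker : maximalIdeal A ≤ LinearMap.ker f := fun a ha => by
    rw [LinearMap.mem_ker, LinearMap.toSpanSingleton_apply, ← Submodule.Quotient.mk_smul]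
    exact (Submodule.Quotient.mk_eq_zero K).mpr (hs a ha)
  have hle : Module.length A (LinearMap.range f) ≤ 1 := by
    rw [← f.quotKerEquivRange.length_eq]
    by_cases h : LinearMap.ker f = ⊤
    · have : Subsingleton (A ⧸ LinearMap.ker f) := Submodule.Quotient.subsingleton_iff.mpr h
      simp
    · rw [← (maximalIdeal.isMaximal A).eq_of_le h hker]
      have : IsSimpleModule A (A ⧸ maximalIdeal A) :=
        isSimpleModule_iff_isCoatom.mpr (maximalIdeal.isMaximal A).out
      rw [Module.length_eq_one]
  have hK : K ≤ K ⊔ Ideal.span {s} := le_sup_left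
  let g : (A ⧸ K) →ₗ[A] A ⧸ (K ⊔ Ideal.span {s}) := Submodule.factor hK
  have hex := Module.length_eq_add_of_exact (LinearMap.range f).subtype g
    (Submodule.subtype_injective _) (Submodule.factor_surjective hK) ?_
  · rw [← Module.length_quotient, ← Module.length_quotient, hex, add_comm]
    gcongr
  · rw [LinearMap.exact_iff, Submodule.range_subtype]
    ext y
    obtain ⟨y, rfl⟩ := Submodule.Quotient.mk_surjective _ y
    have h1 : g (Submodule.Quotient.mk y) = 0 ↔ y ∈ K ⊔ Ideal.span {s} :=
      Submodule.Quotient.mk_eq_zero _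
    rw [LinearMap.mem_ker, h1, Ideal.mem_sup_span_singleton_iff, LinearMap.mem_range]
    refine exists_congr fun a => ?_
    rw [LinearMap.toSpanSingleton_apply, ← Submodule.Quotient.mk_smul, eq_comm,
      Submodule.Quotient.eq, smul_eq_mul]

end SocleGenerator

section Duality

variable {A : Type*} [CommRing A]

theorem Ideal.colon_sup_span_singleton {J K : Ideal A} {s y : A} :
    y ∈ J.colon (K ⊔ Ideal.span {s} : Ideal A) ↔ y ∈ J.colon (K : Set A) ∧ y * s ∈ J := by
  simp only [Submodule.mem_colon, smul_eq_mul, SetLike.mem_coe]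
  constructor
  · exact fun h => ⟨fun k hk => h k (Ideal.mem_sup_left hk),
      h s (Ideal.mem_sup_right (Ideal.mem_span_singleton_self s))⟩
  · rintro ⟨h1, h2⟩ t ht
    obtain ⟨a, ha⟩ := Ideal.mem_sup_span_singleton_iff.mp ht
    have h3 := h1 _ ha
    have h4 := J.mul_mem_left a h2
    convert add_mem h3 h4 using 1; ring

variable [IsLocalRing A]

theorem Ideal.IsSocleGenerator.coheight_colon_le {J K : Ideal A} {w s : A}
    (hw : J.IsSocleGenerator w) (hs : ∀ a ∈ maximalIdeal A, a * s ∈ K) :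
    Order.coheight (J.colon (K ⊔ Ideal.span {s} : Ideal A) : Ideal A) ≤
      Order.coheight (J.colon (K : Set A) : Ideal A) + 1 := by
  set B : Ideal A := J.colon (K ⊔ Ideal.span {s} : Ideal A) with hB
  have hBle : B ≤ J.colon (K : Set A) := fun y hy => (Ideal.colon_sup_span_singleton.mp hy).1
  by_cases h : (J.colon (K : Set A) : Ideal A) ≤ B
  · rw [le_antisymm hBle h]
    exact le_self_add
  obtain ⟨y₀, hy₀, hy₀B⟩ := SetLike.not_le_iff_exists.mp h
  have hy₀s : y₀ * s ∉ J := fun h => hy₀B (Ideal.colon_sup_span_singleton.mpr ⟨hy₀, h⟩)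
  have hsoc : ∀ y ∈ (J.colon (K : Set A) : Ideal A), ∀ a ∈ maximalIdeal A, a * (y * s) ∈ J := by
    intro y hy a ha
    have := Submodule.mem_colon.mp hy _ (hs a ha)
    rw [smul_eq_mul] at this
    convert this using 1; ring
  have hgen : (J.colon (K : Set A) : Ideal A) = B ⊔ Ideal.span {y₀} := by
    refine le_antisymm (fun y hy => ?_)
      (sup_le hBle ((Ideal.span_singleton_le_iff_mem _).mpr hy₀))
    rw [Ideal.mem_sup_span_singleton_iff]
    obtain ⟨a, ha⟩ := hw.2 _ hy₀s
    by_cases hys : y * s ∈ J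
    · exact ⟨0, by simpa using Ideal.colon_sup_span_singleton.mpr ⟨hy, hys⟩⟩
    obtain ⟨b, hb⟩ := hw.2 _ hys
    have hbu : IsUnit b := by
      by_contra hbu
      exact hw.1 (by simpa using add_mem hb (hsoc y hy b hbu))
    obtain ⟨b, rfl⟩ := hbu
    refine ⟨↑b⁻¹ * a, Ideal.colon_sup_span_singleton.mpr
      ⟨sub_mem hy (Ideal.mul_mem_left _ _ hy₀), ?_⟩⟩
    have h1 := J.mul_mem_left (↑b⁻¹ : A) (sub_mem ha hb)
    convert h1 using 1
    linear_combination (-y * s) * b.inv_mul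
  rw [hgen]
  refine Ideal.coheight_le_coheight_sup_span_singleton_add_one B fun a ha =>
    Ideal.colon_sup_span_singleton.mpr ⟨Ideal.mul_mem_left _ _ hy₀, ?_⟩
  rw [mul_assoc]
  exact hsoc y₀ hy₀ a ha

theorem Ideal.coheight_lt_top_of_pow_le [IsNoetherianRing A] {J : Ideal A} {M : ℕ}
    (hM : maximalIdeal A ^ M ≤ J) : Order.coheight J < ⊤ := by
  by_contra hJ
  obtain ⟨L, ⟨hJL, hL⟩, hmax⟩ := WellFounded.has_min (wellFounded_gt (α := Ideal A))
    {L | J ≤ L ∧ ¬ Order.coheight L < ⊤} ⟨J, le_rfl, hJ⟩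
  have htop : ¬ ⊤ ≤ L := by
    intro h
    rw [top_le_iff.mp h, Order.coheight_top] at hL
    exact hL ENat.top_pos
  obtain ⟨s, -, hsL, hs⟩ := Ideal.exists_notMem_forall_mul_mem htop (hM.trans hJL)
  have hlt : L < L ⊔ Ideal.span {s} := lt_of_le_of_ne le_sup_left fun h =>
    hsL (h ▸ Ideal.mem_sup_right (Ideal.mem_span_singleton_self s))
  have hfin : Order.coheight (L ⊔ Ideal.span {s}) < ⊤ :=
    not_not.mp fun h => hmax _ ⟨hJL.trans hlt.le, h⟩ hlt
  exact hL ((L.coheight_le_coheight_sup_span_singleton_add_one hs).trans_lt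
    (ENat.add_lt_top.mpr ⟨hfin, ENat.one_lt_top⟩))

theorem Ideal.IsSocleGenerator.coheight_add_coheight_colon_le [IsNoetherianRing A]
    {J K K' : Ideal A} {w : A} {M : ℕ} (hM : maximalIdeal A ^ M ≤ J) (hw : J.IsSocleGenerator w)
    (hJK : J ≤ K) (hK : K ≤ K') :
    Order.coheight K' + Order.coheight (J.colon (K' : Set A) : Ideal A) ≤
      Order.coheight K + Order.coheight (J.colon (K : Set A) : Ideal A) := by
  let φ : Ideal A → ℕ∞ := fun L =>
    Order.coheight L + Order.coheight (J.colon (L : Set A) : Ideal A)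
  obtain ⟨L, ⟨hKL, hLK', hφ⟩, hmax⟩ := WellFounded.has_min (wellFounded_gt (α := Ideal A))
    {L | K ≤ L ∧ L ≤ K' ∧ φ L ≤ φ K} ⟨K, le_rfl, hK, le_rfl⟩
  by_cases hle : K' ≤ L
  · rw [le_antisymm hle hLK']
    exact hφ
  exfalso
  obtain ⟨s, hsK', hsL, hs⟩ :=
    Ideal.exists_notMem_forall_mul_mem hle (hM.trans (hJK.trans hKL))
  have hlt : L < L ⊔ Ideal.span {s} := lt_of_le_of_ne le_sup_left fun h =>
    hsL (h ▸ Ideal.mem_sup_right (Ideal.mem_span_singleton_self s))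
  refine hmax (L ⊔ Ideal.span {s}) ⟨hKL.trans hlt.le, sup_le hLK'
    ((Ideal.span_singleton_le_iff_mem _).mpr hsK'), le_trans ?_ hφ⟩ hlt
  have h1 : Order.coheight (L ⊔ Ideal.span {s}) + 1 ≤ Order.coheight L :=
    Order.coheight_add_one_le hlt
  calc φ (L ⊔ Ideal.span {s}) ≤ Order.coheight (L ⊔ Ideal.span {s}) +
        (Order.coheight (J.colon (L : Set A) : Ideal A) + 1) :=
        add_le_add le_rfl (hw.coheight_colon_le hs)
    _ = (Order.coheight (L ⊔ Ideal.span {s}) + 1) +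
        Order.coheight (J.colon (L : Set A) : Ideal A) := by ring
    _ ≤ φ L := add_le_add h1 le_rfl

/-- Duality in a zero-dimensional Gorenstein quotient: `J : (J : K) ≤ K`. -/
theorem Ideal.IsSocleGenerator.exists_mul_notMem [IsNoetherianRing A]
    {J K : Ideal A} {w : A} {M : ℕ} (hM : maximalIdeal A ^ M ≤ J) (hw : J.IsSocleGenerator w)
    (hJK : J ≤ K) {s : A} (hs : s ∉ K) :
    ∃ y, (∀ k ∈ K, y * k ∈ J) ∧ y * s ∉ J := by
  by_contra! hcon
  have hlt : K < K ⊔ Ideal.span {s} := lt_of_le_of_ne le_sup_left fun h =>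
    hs (h ▸ Ideal.mem_sup_right (Ideal.mem_span_singleton_self s))
  have hcolon : (J.colon (K ⊔ Ideal.span {s} : Ideal A) : Ideal A) = J.colon (K : Set A) := by
    ext y
    rw [Ideal.colon_sup_span_singleton, and_iff_left_iff_imp]
    exact fun hy => hcon y fun k hk => Submodule.mem_colon.mp hy k hk
  have h1 := hw.coheight_add_coheight_colon_le hM le_rfl hJK
  have h2 := hw.coheight_add_coheight_colon_le hM (hJK.trans hlt.le) le_top
  have hJJ : (J.colon (J : Set A) : Ideal A) = ⊤ := (Submodule.colon_eq_top_iff_subset _).mpr le_rfl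
  have hJT : (J.colon ((⊤ : Ideal A) : Set A) : Ideal A) = J := by simp
  rw [hJJ, Order.coheight_top, add_zero] at h1
  rw [hJT, Order.coheight_top, zero_add, hcolon] at h2
  have h3 : Order.coheight K ≤ Order.coheight (K ⊔ Ideal.span {s}) :=
    (ENat.add_le_add_iff_right ?_).mp (h1.trans h2)
  · exact absurd h3 (not_le.mpr (Order.coheight_strictAnti hlt
      (Ideal.coheight_lt_top_of_pow_le (hM.trans (hJK.trans hlt.le)))))
  · refine (Ideal.coheight_lt_top_of_pow_le (hM.trans ?_)).ne
    exact fun j hj => Submodule.mem_colon.mpr fun k _ => J.mul_mem_right k hj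

end Duality

section RegularMod

variable {A : Type*} [CommRing A]

/-- `xs` is a weakly regular sequence on `A ⧸ L`. -/
def Ideal.RegularMod : Ideal A → List A → Prop
  | _, [] => True
  | L, x :: xs => (∀ s, x * s ∈ L → s ∈ L) ∧ Ideal.RegularMod (L ⊔ Ideal.span {x}) xs

theorem Ideal.mem_of_pow_mul_mem {L : Ideal A} {x : A} (hx : ∀ s, x * s ∈ L → s ∈ L) (k : ℕ)
    {s : A} (hs : x ^ k * s ∈ L) : s ∈ L := by
  induction k with
  | zero => simpa using hs
  | succ k ih => exact ih (hx _ (by rwa [pow_succ', mul_assoc] at hs))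

theorem Ideal.mem_sup_of_mul_mem_sup {L : Ideal A} {x w : A} (hx : ∀ s, x * s ∈ L → s ∈ L)
    (hw : ∀ s, w * s ∈ L ⊔ Ideal.span {x} → s ∈ L ⊔ Ideal.span {x}) {s : A}
    (hs : x * s ∈ L ⊔ Ideal.span {w}) : s ∈ L ⊔ Ideal.span {w} := by
  rw [Ideal.mem_sup_span_singleton_iff] at hs ⊢
  obtain ⟨a, ha⟩ := hs
  have h1 : w * a ∈ L ⊔ Ideal.span {x} := by
    rw [Ideal.mem_sup_span_singleton_iff]
    refine ⟨s, ?_⟩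
    rw [← neg_mem_iff]
    convert ha using 1; ring
  obtain ⟨b, hb⟩ := Ideal.mem_sup_span_singleton_iff.mp (hw a h1)
  refine ⟨b, hx _ ?_⟩
  convert add_mem ha (L.mul_mem_left w hb) using 1; ring

theorem Ideal.mem_sup_span_pow_of_mul_mem {L : Ideal A} {x w : A}
    (hx : ∀ s, x * s ∈ L → s ∈ L)
    (hw : ∀ s, w * s ∈ L ⊔ Ideal.span {x} → s ∈ L ⊔ Ideal.span {x}) (k : ℕ) {s : A}
    (hs : w * s ∈ L ⊔ Ideal.span {x ^ k}) : s ∈ L ⊔ Ideal.span {x ^ k} := by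
  induction k generalizing s with
  | zero => simp [Ideal.span_singleton_one]
  | succ k ih =>
    obtain ⟨a, ha⟩ := Ideal.mem_sup_span_singleton_iff.mp hs
    have h1 : w * s ∈ L ⊔ Ideal.span {x} :=
      Ideal.mem_sup_span_singleton_iff.mpr ⟨a * x ^ k, by convert ha using 1; ring⟩
    obtain ⟨b, hb⟩ := Ideal.mem_sup_span_singleton_iff.mp (hw s h1)
    have h2 : w * b ∈ L ⊔ Ideal.span {x ^ k} := by
      refine Ideal.mem_sup_span_singleton_iff.mpr ⟨a, hx _ ?_⟩
      convert sub_mem ha (L.mul_mem_left w hb) using 1; ring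
    obtain ⟨d, hd⟩ := Ideal.mem_sup_span_singleton_iff.mp (ih h2)
    refine Ideal.mem_sup_span_singleton_iff.mpr ⟨d, ?_⟩
    convert add_mem hb (L.mul_mem_left x hd) using 1; ring

theorem Ideal.RegularMod.sup_span_pow {L : Ideal A} {x : A} {xs : List A}
    (hx : ∀ s, x * s ∈ L → s ∈ L) (h : (L ⊔ Ideal.span {x}).RegularMod xs) (k : ℕ) :
    (L ⊔ Ideal.span {x ^ k}).RegularMod xs := by
  induction xs generalizing L with
  | nil => trivial
  | cons w ws ih =>
    refine ⟨fun s => Ideal.mem_sup_span_pow_of_mul_mem hx h.1 k, ?_⟩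
    rw [sup_right_comm]
    refine ih (fun s => Ideal.mem_sup_of_mul_mem_sup hx h.1) ?_
    rw [sup_right_comm]
    exact h.2

theorem Ideal.RegularMod.mem_sup_ofList_of_mul_mem {L : Ideal A} {x : A} {xs : List A}
    (hx : ∀ s, x * s ∈ L → s ∈ L) (h : (L ⊔ Ideal.span {x}).RegularMod xs) {s : A}
    (hs : x * s ∈ L ⊔ Ideal.ofList xs) : s ∈ L ⊔ Ideal.ofList xs := by
  induction xs generalizing L with
  | nil => simpa using hx s (by simpa using hs)
  | cons w ws ih =>
    rw [Ideal.ofList_cons, ← sup_assoc] at hs ⊢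
    refine ih (fun s => Ideal.mem_sup_of_mul_mem_sup hx h.1) ?_ hs
    rw [sup_right_comm]
    exact h.2

theorem Ideal.RegularMod.map_pow {L : Ideal A} {xs : List A} (h : L.RegularMod xs) (k : ℕ) :
    L.RegularMod (xs.map (· ^ k)) := by
  induction xs generalizing L with
  | nil => trivial
  | cons x xs ih =>
    exact ⟨fun s => Ideal.mem_of_pow_mul_mem h.1 k, ih (h.2.sup_span_pow h.1 k)⟩

theorem Ideal.IsSocleGenerator.sup_span_pow {L : Ideal A} {x v : A}
    (hx : ∀ s, x * s ∈ L → s ∈ L) (hv : (L ⊔ Ideal.span {x}).IsSocleGenerator v) (k : ℕ) :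
    (L ⊔ Ideal.span {x ^ (k + 1)}).IsSocleGenerator (x ^ k * v) := by
  constructor
  · intro h
    obtain ⟨a, ha⟩ := Ideal.mem_sup_span_singleton_iff.mp h
    refine hv.1 (Ideal.mem_sup_span_singleton_iff.mpr ⟨a, Ideal.mem_of_pow_mul_mem hx k ?_⟩)
    convert ha using 1; ring
  · intro s hs
    have key : ∀ j, s ∉ L ⊔ Ideal.span {x ^ j} → ∃ i < j, ∃ s', s - x ^ i * s' ∈ L ∧
        s' ∉ L ⊔ Ideal.span {x} := by
      intro j
      induction j with
      | zero => intro h; simp [Ideal.span_singleton_one] at h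
      | succ j ih =>
        intro h
        by_cases hj : s ∈ L ⊔ Ideal.span {x ^ j}
        · obtain ⟨a, ha⟩ := Ideal.mem_sup_span_singleton_iff.mp hj
          refine ⟨j, j.lt_succ_self, a, by rwa [mul_comm], fun h' => h ?_⟩
          obtain ⟨b, hb⟩ := Ideal.mem_sup_span_singleton_iff.mp h'
          refine Ideal.mem_sup_span_singleton_iff.mpr ⟨b, ?_⟩
          convert add_mem ha (L.mul_mem_left (x ^ j) hb) using 1; ring
        · obtain ⟨i, hi, h⟩ := ih hj
          exact ⟨i, hi.trans j.lt_succ_self, h⟩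
    obtain ⟨i, hi, s', hs', hs'n⟩ := key _ hs
    obtain ⟨a, ha⟩ := hv.2 s' hs'n
    obtain ⟨b, hb⟩ := Ideal.mem_sup_span_singleton_iff.mp ha
    obtain ⟨m, rfl⟩ := Nat.exists_eq_add_of_le (Nat.lt_succ_iff.mp hi)
    refine ⟨x ^ m * a, Ideal.mem_sup_span_singleton_iff.mpr ⟨b, ?_⟩⟩
    convert sub_mem (L.mul_mem_left (x ^ (i + m)) hb) (L.mul_mem_left (x ^ m * a) hs') using 1
    ring

theorem Ideal.IsSocleGenerator.exists_ofList_map_pow {L : Ideal A} {xs : List A} {v : A}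
    (hreg : L.RegularMod xs) (hv : (L ⊔ Ideal.ofList xs).IsSocleGenerator v) (k : ℕ) :
    ∃ v', (L ⊔ Ideal.ofList (xs.map (· ^ (k + 1)))).IsSocleGenerator v' := by
  induction xs generalizing L v with
  | nil => exact ⟨v, hv⟩
  | cons x xs ih =>
    rw [Ideal.ofList_cons, ← sup_assoc, sup_right_comm] at hv
    have := hv.sup_span_pow (fun s => hreg.2.mem_sup_ofList_of_mul_mem hreg.1) k
    rw [sup_right_comm] at this
    obtain ⟨v', hv'⟩ := ih (hreg.2.sup_span_pow hreg.1 (k + 1)) this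
    exact ⟨v', by rwa [List.map_cons, Ideal.ofList_cons, ← sup_assoc]⟩

theorem Ideal.RegularMod.of_forall_take {L : Ideal A} {xs : List A}
    (h : ∀ i (hi : i < xs.length), ∀ s, xs[i] * s ∈ L ⊔ Ideal.ofList (xs.take i) →
      s ∈ L ⊔ Ideal.ofList (xs.take i)) : L.RegularMod xs := by
  induction xs generalizing L with
  | nil => trivial
  | cons x xs ih =>
    refine ⟨fun s hs => ?_, ih fun i hi s hs => ?_⟩
    · simpa using h 0 (by simp) s (by simpa using hs)
    · have := h (i + 1) (by simpa using hi) s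
      simp only [List.getElem_cons_succ, List.take_succ_cons, Ideal.ofList_cons, ← sup_assoc]
        at this
      exact this hs

theorem Ideal.RegularMod.of_isWeaklyRegular {xs : List A}
    (h : RingTheory.Sequence.IsWeaklyRegular A xs) : (⊥ : Ideal A).RegularMod xs := by
  refine .of_forall_take fun i hi s hs => ?_
  have h1 := h.regular_mod_prev i hi
  rw [bot_sup_eq] at hs ⊢
  have h2 : (Ideal.ofList (xs.take i) • ⊤ : Ideal A) = Ideal.ofList (xs.take i) := by simp
  rw [← h2, ← Submodule.Quotient.mk_eq_zero] at hs ⊢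
  exact h1.right_eq_zero_of_smul hs

theorem Ideal.RegularMod.comap {B : Type*} [CommRing B] {f : A →+* B}
    (hf : Function.Surjective f) {L : Ideal B} {xs : List A} (h : L.RegularMod (xs.map f)) :
    (L.comap f).RegularMod xs := by
  induction xs generalizing L with
  | nil => trivial
  | cons x xs ih =>
    refine ⟨fun s hs => ?_, ?_⟩
    · rw [Ideal.mem_comap, map_mul] at hs
      exact h.1 _ hs
    · have := ih h.2
      convert this using 1
      ext s
      simp only [Ideal.mem_comap, Ideal.mem_sup_span_singleton_iff, hf.exists, map_sub, map_mul]

end RegularMod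

section FlatMod

variable {R S : Type*} [CommRing R] [CommRing S] [Algebra R S]

theorem Ideal.mem_map_colon_of_flat [Module.Flat R S] {𝔞 : Ideal R} {r : R} {s : S}
    (h : algebraMap R S r * s ∈ 𝔞.map (algebraMap R S)) :
    s ∈ (𝔞.colon {r} : Ideal R).map (algebraMap R S) := by
  have h1 : algebraMap R S r * s ∈ Submodule.span S (algebraMap R S '' (𝔞 : Set R)) := h
  obtain ⟨n, c, g, hg⟩ := Submodule.mem_span_set'.mp h1
  choose a ha hag using fun i => (g i).2
  let f : Option (Fin n) → R := fun o => o.elim r fun i => - a i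
  let x : Option (Fin n) → S := fun o => o.elim s c
  have hfx : ∑ i, f i • x i = 0 := by
    rw [Fintype.sum_option]
    simp only [f, x, Option.elim, Algebra.smul_def, map_neg, neg_mul, Finset.sum_neg_distrib,
      hag, ← hg]
    rw [add_neg_eq_zero]
    exact Finset.sum_congr rfl fun i _ => mul_comm _ _
  obtain ⟨k, b, y, hxy, hb⟩ := Module.Flat.isTrivialRelation_of_sum_smul_eq_zero (R := R) (M := S) hfx
  have hs : s = ∑ j, b none j • y j := hxy none
  rw [hs]
  refine Ideal.sum_mem _ fun j _ => ?_
  rw [Algebra.smul_def]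
  refine Ideal.mul_mem_right _ _ (Ideal.mem_map_of_mem _ (Submodule.mem_colon_singleton.mpr ?_))
  have := hb j
  rw [Fintype.sum_option] at this
  simp only [f, Option.elim, neg_mul, Finset.sum_neg_distrib, add_neg_eq_zero] at this
  rw [smul_eq_mul, mul_comm, this]
  exact Ideal.sum_mem _ fun i _ => 𝔞.mul_mem_right _ (ha i)

theorem Ideal.mem_map_sup_span_singleton_sup_iff {𝔞 : Ideal R} {r : R} {L : Ideal S} {s : S} :
    s ∈ (𝔞 ⊔ Ideal.span {r}).map (algebraMap R S) ⊔ L ↔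
      ∃ b, s - b * algebraMap R S r ∈ 𝔞.map (algebraMap R S) ⊔ L := by
  rw [Ideal.map_sup, Ideal.map_span, Set.image_singleton, sup_right_comm,
    Ideal.mem_sup_span_singleton_iff]

variable [IsLocalRing R]

variable (R) in
/-- `S ⧸ L` is flat over `R`, tested on colons of ideals containing a power of the maximal ideal:
`(𝔞 S + L) : r = (𝔞 : r) S + L`. -/
def Ideal.ColonFlat (L : Ideal S) : Prop :=
  ∀ (𝔞 : Ideal R) (N : ℕ), maximalIdeal R ^ N ≤ 𝔞 → ∀ (r : R) (s : S),
    algebraMap R S r * s ∈ 𝔞.map (algebraMap R S) ⊔ L →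
      s ∈ (𝔞.colon {r} : Ideal R).map (algebraMap R S) ⊔ L

variable (R S) in
theorem Ideal.colonFlat_bot [Module.Flat R S] : Ideal.ColonFlat R (⊥ : Ideal S) := by
  intro 𝔞 N _ r s h
  rw [sup_bot_eq] at h ⊢
  exact Ideal.mem_map_colon_of_flat h

theorem Ideal.colon_le_maximalIdeal {𝔞 : Ideal R} {r : R} (hr : r ∉ 𝔞) :
    (𝔞.colon {r} : Ideal R) ≤ maximalIdeal R :=
  IsLocalRing.le_maximalIdeal fun h => hr (by
    have : (1 : R) ∈ (𝔞.colon {r} : Ideal R) := h ▸ Submodule.mem_top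
    simpa using this)

theorem Ideal.ColonFlat.mem_of_mul_mem [IsNoetherianRing R] {L : Ideal S}
    (hL : Ideal.ColonFlat R L) {z : S}
    (hz : ∀ s, z * s ∈ (maximalIdeal R).map (algebraMap R S) ⊔ L →
      s ∈ (maximalIdeal R).map (algebraMap R S) ⊔ L)
    {𝔞 : Ideal R} {N : ℕ} (hN : maximalIdeal R ^ N ≤ 𝔞) {s : S}
    (hs : z * s ∈ 𝔞.map (algebraMap R S) ⊔ L) : s ∈ 𝔞.map (algebraMap R S) ⊔ L := by
  induction 𝔞 using WellFoundedGT.induction generalizing s with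
  | ind 𝔞 ih =>
  by_cases htop : ⊤ ≤ 𝔞
  · rw [top_le_iff.mp htop, Ideal.map_top, top_sup_eq]
    trivial
  obtain ⟨r, -, hr𝔞, hr⟩ := Ideal.exists_notMem_forall_mul_mem htop hN
  have hlt : 𝔞 < 𝔞 ⊔ Ideal.span {r} := lt_of_le_of_ne le_sup_left fun h =>
    hr𝔞 (h ▸ Ideal.mem_sup_right (Ideal.mem_span_singleton_self r))
  obtain ⟨b, hb⟩ := Ideal.mem_map_sup_span_singleton_sup_iff.mp
    (ih _ hlt (hN.trans hlt.le) (sup_le_sup_right (Ideal.map_mono hlt.le) L hs))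
  have h1 : algebraMap R S r * (z * b) ∈ 𝔞.map (algebraMap R S) ⊔ L := by
    convert sub_mem hs (Ideal.mul_mem_left _ z hb) using 1; ring
  have h2 := hz b (sup_le_sup_right (Ideal.map_mono (Ideal.colon_le_maximalIdeal hr𝔞)) L
    (hL 𝔞 N hN r _ h1))
  have h3 : b * algebraMap R S r ∈ 𝔞.map (algebraMap R S) ⊔ L := by
    obtain ⟨i, hi, l, hl, rfl⟩ := Submodule.mem_sup.mp h2
    rw [add_mul]
    refine add_mem (Ideal.mem_sup_left ?_) (Ideal.mul_mem_right _ _ (Ideal.mem_sup_right hl))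
    have h4 : (maximalIdeal R).map (algebraMap R S) ≤
        (𝔞.map (algebraMap R S)).colon {algebraMap R S r} := by
      rw [Ideal.map_le_iff_le_comap]
      intro a ha
      rw [Ideal.mem_comap, Submodule.mem_colon_singleton, smul_eq_mul, ← map_mul]
      exact Ideal.mem_map_of_mem _ (hr a ha)
    exact Submodule.mem_colon_singleton.mp (h4 hi)
  simpa using add_mem hb h3

theorem Ideal.ColonFlat.sup_span_singleton [IsNoetherianRing R] {L : Ideal S}
    (hL : Ideal.ColonFlat R L) {z : S}
    (hz : ∀ s, z * s ∈ (maximalIdeal R).map (algebraMap R S) ⊔ L →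
      s ∈ (maximalIdeal R).map (algebraMap R S) ⊔ L) :
    Ideal.ColonFlat R (L ⊔ Ideal.span {z}) := by
  intro 𝔞 N hN r s hs
  rw [← sup_assoc, Ideal.mem_sup_span_singleton_iff] at hs ⊢
  obtain ⟨b, hb⟩ := hs
  have h1 : z * b ∈ (𝔞 ⊔ Ideal.span {r}).map (algebraMap R S) ⊔ L := by
    refine Ideal.mem_map_sup_span_singleton_sup_iff.mpr ⟨s, ?_⟩
    rw [← neg_mem_iff]
    convert hb using 1; ring
  obtain ⟨b', hb'⟩ := Ideal.mem_map_sup_span_singleton_sup_iff.mp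
    (hL.mem_of_mul_mem hz (hN.trans le_sup_left) h1)
  refine ⟨b', hL 𝔞 N hN r _ ?_⟩
  convert add_mem hb (Ideal.mul_mem_left _ z hb') using 1; ring

theorem Ideal.ColonFlat.sup_ofList [IsNoetherianRing R] {L : Ideal S} (hL : Ideal.ColonFlat R L)
    {zs : List S} (hz : ((maximalIdeal R).map (algebraMap R S) ⊔ L).RegularMod zs) :
    Ideal.ColonFlat R (L ⊔ Ideal.ofList zs) := by
  induction zs generalizing L with
  | nil => simpa using hL
  | cons z zs ih =>
    rw [Ideal.ofList_cons, ← sup_assoc]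
    exact ih (hL.sup_span_singleton hz.1) (by rw [← sup_assoc]; exact hz.2)

/-- The socle of `S ⧸ (I S + L)` is the product of the socles of `R ⧸ I` and of the closed fibre
of `S ⧸ L`. -/
theorem Ideal.ColonFlat.isSocleGenerator_mul [IsNoetherianRing R] {L : Ideal S}
    (hL : Ideal.ColonFlat R L) {I : Ideal R} {N : ℕ} (hN : maximalIdeal R ^ N ≤ I)
    {u : R} (hu : I.IsSocleGenerator u) {v : S}
    (hv : ((maximalIdeal R).map (algebraMap R S) ⊔ L).IsSocleGenerator v) :
    (I.map (algebraMap R S) ⊔ L).IsSocleGenerator (algebraMap R S u * v) := by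
  have hmul : ∀ (𝔞 : Ideal R) (r : R), (∀ a ∈ 𝔞, r * a ∈ I) → ∀ b ∈ 𝔞.map (algebraMap R S) ⊔ L,
      algebraMap R S r * b ∈ I.map (algebraMap R S) ⊔ L := by
    intro 𝔞 r hr b hb
    obtain ⟨i, hi, l, hl, rfl⟩ := Submodule.mem_sup.mp hb
    rw [mul_add]
    refine add_mem (Ideal.mem_sup_left ?_) (Ideal.mul_mem_left _ _ (Ideal.mem_sup_right hl))
    have h4 : 𝔞.map (algebraMap R S) ≤
        (I.map (algebraMap R S)).colon {algebraMap R S r} := by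
      rw [Ideal.map_le_iff_le_comap]
      intro a ha
      rw [Ideal.mem_comap, Submodule.mem_colon_singleton, smul_eq_mul, ← map_mul, mul_comm]
      exact Ideal.mem_map_of_mem _ (hr a ha)
    rw [mul_comm]
    exact Submodule.mem_colon_singleton.mp (h4 hi)
  constructor
  · exact fun h => hv.1 (sup_le_sup_right (Ideal.map_mono (Ideal.colon_le_maximalIdeal hu.1)) L
      (hL I N hN u v h))
  · intro s hs
    obtain ⟨𝔟, ⟨hI𝔟, hs𝔟⟩, hmax⟩ := WellFounded.has_min (wellFounded_gt (α := Ideal R))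
      {𝔟 | I ≤ 𝔟 ∧ s ∉ 𝔟.map (algebraMap R S) ⊔ L} ⟨I, le_rfl, hs⟩
    have htop : ¬ ⊤ ≤ 𝔟 := by
      intro h
      rw [top_le_iff.mp h, Ideal.map_top, top_sup_eq] at hs𝔟
      exact hs𝔟 trivial
    obtain ⟨r, -, hr𝔟, hr⟩ := Ideal.exists_notMem_forall_mul_mem htop (hN.trans hI𝔟)
    have hlt : 𝔟 < 𝔟 ⊔ Ideal.span {r} := lt_of_le_of_ne le_sup_left fun h =>
      hr𝔟 (h ▸ Ideal.mem_sup_right (Ideal.mem_span_singleton_self r))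
    obtain ⟨s', hs'⟩ := Ideal.mem_map_sup_span_singleton_sup_iff.mp
      (not_not.mp fun h => hmax _ ⟨hI𝔟.trans hlt.le, h⟩ hlt)
    obtain ⟨y, hy𝔟, hyr⟩ := hu.exists_mul_notMem hN hI𝔟 hr𝔟
    obtain ⟨a, ha⟩ := hu.2 _ hyr
    have hs'n : s' ∉ (maximalIdeal R).map (algebraMap R S) ⊔ L := by
      intro h
      apply hs𝔟
      obtain ⟨i, hi, l, hl, rfl⟩ := Submodule.mem_sup.mp h
      have h4 : (maximalIdeal R).map (algebraMap R S) ≤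
          (𝔟.map (algebraMap R S)).colon {algebraMap R S r} := by
        rw [Ideal.map_le_iff_le_comap]
        intro a ha
        rw [Ideal.mem_comap, Submodule.mem_colon_singleton, smul_eq_mul, ← map_mul]
        exact Ideal.mem_map_of_mem _ (hr a ha)
      have h5 : i * algebraMap R S r ∈ 𝔟.map (algebraMap R S) :=
        Submodule.mem_colon_singleton.mp (h4 hi)
      have h6 : l * algebraMap R S r ∈ L := Ideal.mul_mem_right _ _ hl
      have := add_mem hs' (add_mem (Ideal.mem_sup_left h5) (Ideal.mem_sup_right h6))
      convert this using 1; ring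
    obtain ⟨d, hd⟩ := hv.2 s' hs'n
    refine ⟨d * algebraMap R S (a * y), ?_⟩
    have h1 := hmul (maximalIdeal R) u (fun a ha => by rw [mul_comm]; exact hu.mul_mem ha) _ hd
    have h2 := hmul 𝔟 y hy𝔟 _ hs'
    have h3 : algebraMap R S (u - a * (y * r)) ∈ I.map (algebraMap R S) ⊔ L :=
      Ideal.mem_sup_left (Ideal.mem_map_of_mem _ ha)
    have h4 := add_mem (add_mem h1 (Ideal.mul_mem_left _ (d * s') h3))
      (neg_mem (Ideal.mul_mem_left _ (d * algebraMap R S a) h2))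
    convert h4 using 1
    simp only [map_sub, map_mul]
    ring

end FlatMod

section Frobenius

theorem Ideal.frobPow_eq_map {A : Type*} [CommRing A] (p : ℕ) [ExpChar A p] (I : Ideal A) (e : ℕ) :
    I.frobPow (p ^ e) = I.map (iterateFrobenius A p e) := rfl

variable {A : Type*} [CommRing A]

theorem Ideal.pow_mem_frobPow {I : Ideal A} {x : A} (hx : x ∈ I) (q : ℕ) : x ^ q ∈ I.frobPow q :=
  Ideal.subset_span ⟨x, hx, rfl⟩

theorem Ideal.frobPow_le_of_forall_mul_mem {I J : Ideal A} {y : A} (h : ∀ k ∈ I, y * k ∈ J) {q : ℕ}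
    {s : A} (hs : s ∈ I.frobPow q) : y ^ q * s ∈ J.frobPow q := by
  induction hs using Submodule.span_induction with
  | mem x hx =>
    obtain ⟨k, hk, rfl⟩ := hx
    simp only
    rw [← mul_pow]
    exact Ideal.pow_mem_frobPow (h k hk) q
  | zero => simp
  | add x y _ _ hx hy => rw [mul_add]; exact add_mem hx hy
  | smul a x _ hx => rw [smul_eq_mul, mul_left_comm]; exact Ideal.mul_mem_left _ _ hx

theorem MemTightClosure.of_mul {p : ℕ} {K J : Ideal A} {s y : A} (hs : MemTightClosure p K s)
    (h : ∀ k ∈ K, y * k ∈ J) : MemTightClosure p J (y * s) := by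
  obtain ⟨c, hc, N, hN⟩ := hs
  refine ⟨c, hc, N, fun e he => ?_⟩
  rw [mul_pow, mul_left_comm]
  exact Ideal.frobPow_le_of_forall_mul_mem h (hN e he)

theorem MemTightClosure.of_sub_mul_mem (p : ℕ) [ExpChar A p] {J : Ideal A} {w a s : A}
    (hs : MemTightClosure p J s) (h : w - a * s ∈ J) : MemTightClosure p J w := by
  obtain ⟨c, hc, N, hN⟩ := hs
  refine ⟨c, hc, N, fun e he => ?_⟩
  have h1 := Ideal.pow_mem_frobPow h (p ^ e)
  rw [sub_pow_expChar_pow, mul_pow] at h1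
  have := add_mem (Ideal.mul_mem_left _ c h1) (Ideal.mul_mem_left _ (a ^ p ^ e) (hN e he))
  convert this using 1; ring

theorem Ideal.pow_mem_frobPow_of_le (p : ℕ) [ExpChar A p] {I : Ideal A} {x : A} {e e' : ℕ}
    (he : e ≤ e') (hx : x ^ p ^ e ∈ I.frobPow (p ^ e)) : x ^ p ^ e' ∈ I.frobPow (p ^ e') := by
  obtain ⟨d, rfl⟩ := Nat.exists_eq_add_of_le he
  rw [Ideal.frobPow_eq_map] at hx ⊢
  have := Ideal.mem_map_of_mem (iterateFrobenius A p d) hx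
  rw [Ideal.map_map, iterateFrobenius_def, ← pow_mul, ← pow_add] at this
  convert this using 2
  ext y
  simp only [iterateFrobenius_def, RingHom.comp_apply, ← pow_mul, ← pow_add]

theorem one_mem_circComplement : (1 : A) ∈ circComplement A := fun _ hP h =>
  hP.1.1.ne_top ((Ideal.eq_top_iff_one _).mpr h)

theorem IsWeaklyFRegular.pow_notMem_frobPow {p : ℕ} [ExpChar A p] (hA : IsWeaklyFRegular A p)
    {I : Ideal A} {u : A} (hu : u ∉ I) (e : ℕ) : u ^ p ^ e ∉ I.frobPow (p ^ e) := fun h =>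
  hu (hA I u ⟨1, one_mem_circComplement, e, fun e' he' => by
    rw [one_mul]; exact Ideal.pow_mem_frobPow_of_le p he' h⟩)

theorem Ideal.frobPow_map_sup_ofList {B : Type*} [CommRing B] [Algebra A B] (p : ℕ) [ExpChar A p]
    [ExpChar B p] (I : Ideal A) (zs : List B) (e : ℕ) :
    (I.map (algebraMap A B) ⊔ Ideal.ofList zs).frobPow (p ^ e) =
      (I.frobPow (p ^ e)).map (algebraMap A B) ⊔ Ideal.ofList (zs.map (· ^ p ^ e)) := by
  rw [Ideal.frobPow_eq_map, Ideal.frobPow_eq_map, Ideal.map_sup, Ideal.map_ofList, Ideal.map_map,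
    Ideal.map_map]
  congr 2
  ext x
  simp [iterateFrobenius_def]

theorem Ideal.exists_pow_le_frobPow [IsLocalRing A] [IsNoetherianRing A] {I : Ideal A} {M : ℕ}
    (hM : maximalIdeal A ^ M ≤ I) (q : ℕ) : ∃ N, maximalIdeal A ^ N ≤ I.frobPow q := by
  refine Ideal.exists_pow_le_of_le_radical_of_fg (fun a ha => ?_) (IsNoetherian.noetherian _)
  exact ⟨M * q, by rw [pow_mul]; exact Ideal.pow_mem_frobPow (hM (Ideal.pow_mem_pow ha M)) q⟩

end Frobenius

section FRational

variable {A : Type*} [CommRing A] [IsLocalRing A] [IsNoetherianRing A]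

variable (A) in
theorem exists_isSystemOfParameters : ∃ (n : ℕ) (x : Fin n → A), IsSystemOfParameters A x := by
  obtain ⟨s, hs, hcard⟩ :=
    Ideal.exists_finset_card_eq_height_of_isNoetherianRing (maximalIdeal A)
  refine ⟨s.card, fun i => s.equivFin.symm i, ?_, fun i => ?_, ?_⟩
  · rw [← IsLocalRing.maximalIdeal_height_eq_ringKrullDim, ← hcard]
    rfl
  · exact hs.1.2 (Ideal.subset_span (s.equivFin.symm i).2)
  · have hrange : Set.range (fun i => (s.equivFin.symm i : A)) = s := by
      ext a
      simp only [Set.mem_range, SetLike.mem_coe]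
      refine ⟨?_, fun ha => ⟨s.equivFin ⟨a, ha⟩, by simp⟩⟩
      rintro ⟨i, rfl⟩
      exact (s.equivFin.symm i).2
    rw [hrange, Ideal.radical_eq_sInf]
    refine le_sInf ?_
    rintro P ⟨hP, hPp⟩
    exact hs.2 ⟨hPp, hP⟩ (IsLocalRing.le_maximalIdeal hPp.ne_top)

theorem Ideal.isParameterIdeal_bot : (⊥ : Ideal A).IsParameterIdeal := by
  obtain ⟨n, x, hx⟩ := exists_isSystemOfParameters A
  exact ⟨n, 0, n.zero_le, x, hx, by simp⟩

theorem Ideal.isParameterIdeal_span_singleton {a : A} (ha : a ∈ nonZeroDivisors A)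
    (ham : a ∈ maximalIdeal A) : (Ideal.span {a}).IsParameterIdeal := by
  have hne : Ideal.span {a} ≠ ⊤ := fun h =>
    (maximalIdeal.isMaximal A).ne_top (top_le_iff.mp
      (h ▸ (Ideal.span_singleton_le_iff_mem _).mpr ham))
  have : Nontrivial (A ⧸ Ideal.span {a}) := Ideal.Quotient.nontrivial_iff.mpr hne
  have : IsLocalRing (A ⧸ Ideal.span {a}) :=
    IsLocalRing.of_surjective' _ Ideal.Quotient.mk_surjective
  have : IsLocalHom (Ideal.Quotient.mk (Ideal.span {a})) := .of_surjective _ Ideal.Quotient.mk_surjective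
  obtain ⟨n, y, hdim, hy, hrad⟩ := exists_isSystemOfParameters (A ⧸ Ideal.span {a})
  choose x hx using fun i => Ideal.Quotient.mk_surjective (I := Ideal.span {a}) (y i)
  refine ⟨n + 1, 1, by omega, Fin.cons a x, ⟨?_, ?_, ?_⟩, ?_⟩
  · rw [← ringKrullDim_quotient_span_singleton_succ_eq_ringKrullDim_of_mem_nonZeroDivisors ha ham,
      hdim]
    rfl
  · refine Fin.cases ham fun i => ?_
    rw [Fin.cons_succ, mem_maximalIdeal, mem_nonunits_iff]
    intro h
    have := hy i
    rw [← hx i] at this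
    exact this (h.map _)
  · intro b hb
    have hb' : Ideal.Quotient.mk (Ideal.span {a}) b ∈ maximalIdeal (A ⧸ Ideal.span {a}) :=
      fun h => hb (isUnit_of_map_unit _ _ h)
    obtain ⟨k, hk⟩ := hrad hb'
    have hmap : Ideal.span (Set.range y) =
        (Ideal.span (Set.range x)).map (Ideal.Quotient.mk (Ideal.span {a})) := by
      rw [Ideal.map_span, ← Set.range_comp]
      exact congrArg _ (congrArg _ (funext fun i => (hx i).symm))
    rw [hmap, ← map_pow] at hk
    obtain ⟨t, ht, hkt⟩ := (Ideal.mem_map_iff_of_surjective _ Ideal.Quotient.mk_surjective).mp hk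
    refine ⟨k, ?_⟩
    rw [Fin.range_cons, Set.insert_eq, Ideal.span_union]
    have := add_mem (Ideal.mem_sup_left (Ideal.Quotient.eq.mp hkt.symm)) (Ideal.mem_sup_right ht)
    rwa [sub_add_cancel] at this
  · rw [Set.range_unique]
    rfl

theorem IsFRational.eq_zero_of_isNilpotent {p : ℕ} [ExpChar A p] (hp : 1 < p)
    (hF : IsFRational A p) {x : A} (hx : IsNilpotent x) : x = 0 := by
  obtain ⟨N, hN⟩ := hx
  refine hF ⊥ Ideal.isParameterIdeal_bot x ⟨1, one_mem_circComplement, N, fun e he => ?_⟩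
  rw [pow_eq_zero_of_le (he.trans (Nat.lt_pow_self hp).le) hN, mul_zero]
  exact zero_mem _

theorem IsFRational.mem_circComplement {p : ℕ} [ExpChar A p] (hp : 1 < p)
    (hF : IsFRational A p) {c : A} (hc : c ≠ 0) : c ∈ circComplement A := by
  have hred : ∀ x : A, x * x = 0 → x = 0 := fun x hx =>
    hF.eq_zero_of_isNilpotent hp ⟨2, by rw [sq, hx]⟩
  suffices h : c ∈ nonZeroDivisors A from
    fun P hP hcP => notMem_nonZeroDivisors_of_mem_mem_minimalPrimes hcP hP h
  obtain ⟨a, haJ, ha⟩ : ((Ideal.span {c} ⊔ (Ideal.span {c}).annihilator : Ideal A) ∩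
      (nonZeroDivisors A : Set A) : Set A).Nonempty := by
    by_contra h
    rw [Set.not_nonempty_iff_eq_empty, ← Set.disjoint_iff_inter_eq_empty] at h
    obtain ⟨-, z, hz, hz0⟩ := SetLike.lt_iff_le_and_exists.mp
      (Ideal.bot_lt_annihilator_of_disjoint_nonZeroDivisors h)
    have hzJ : ∀ b ∈ Ideal.span {c} ⊔ (Ideal.span {c}).annihilator, z * b = 0 :=
      fun b hb => Submodule.mem_annihilator.mp hz b hb
    refine hz0 (hred z (hzJ z (Ideal.mem_sup_right ?_)))
    rw [Submodule.mem_annihilator_span_singleton]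
    exact hzJ c (Ideal.mem_sup_left (Ideal.mem_span_singleton_self c))
  obtain ⟨d, hd, y, hy, rfl⟩ := Submodule.mem_sup.mp haJ
  obtain ⟨r, rfl⟩ := Ideal.mem_span_singleton'.mp hd
  rw [Submodule.mem_annihilator_span_singleton, smul_eq_mul] at hy
  by_cases hu : IsUnit (r * c + y)
  · rcases IsLocalRing.isUnit_or_isUnit_of_isUnit_add hu with h | h
    · exact (isUnit_of_mul_isUnit_right h).mem_nonZeroDivisors
    · exact absurd ((h.mul_right_eq_zero).mp hy) hc
  have hmem : r * c ∈ Ideal.span {r * c + y} := by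
    refine hF _ (Ideal.isParameterIdeal_span_singleton ha hu) _
      ⟨r * c + y, fun P hP hcP => notMem_nonZeroDivisors_of_mem_mem_minimalPrimes hcP hP ha,
        0, fun e _ => ?_⟩
    have h1 : (r * c + y) * (r * c) ^ p ^ e = (r * c) * (r * c + y) ^ p ^ e := by
      obtain ⟨k, hk⟩ := Nat.exists_eq_succ_of_ne_zero (pow_pos (zero_lt_one.trans hp) e).ne'
      rw [add_pow_expChar_pow, hk, Nat.succ_eq_add_one]
      linear_combination (r * (r * c) ^ k - r * y ^ k) * hy
    rw [h1]
    exact Ideal.mul_mem_left _ _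
      (Ideal.pow_mem_frobPow (Ideal.mem_span_singleton_self _) _)
  obtain ⟨t, ht⟩ := Ideal.mem_span_singleton'.mp hmem
  rcases IsLocalRing.isUnit_or_isUnit_one_sub_self t with h | h
  · have hy0 : y = 0 :=
      hred y (h.mul_right_eq_zero.mp (by linear_combination y * ht + (1 - t) * r * hy))
    rw [hy0, add_zero] at ha
    exact (mul_mem_nonZeroDivisors.mp ha).2
  · have hc0 : r * c = 0 :=
      hred _ (h.mul_right_eq_zero.mp (by linear_combination - (r * c) * ht + t * r * hy))
    rw [hc0, zero_add] at ha
    exact absurd ((mem_nonZeroDivisors_iff.mp ha).1 c hy) hc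

end FRational

section ApproximatelyGorenstein

variable {A : Type*} [CommRing A]

theorem Ideal.ofList_ofFn {n : ℕ} (x : Fin n → A) :
    Ideal.ofList (List.ofFn x) = Ideal.span (Set.range x) := by
  rw [Ideal.ofList]
  congr 1
  ext a
  simp [List.mem_ofFn]

theorem Ideal.IsIrreducible.of_infIrred {I : Ideal A} (hI : InfIrred I) : I.IsIrreducible :=
  ⟨fun h => hI.1 (h ▸ isMax_top), fun _ _ h => (hI.2 h.symm).imp Eq.symm Eq.symm⟩

theorem Ideal.exists_isSocleGenerator_of_notMem [IsNoetherianRing A] {J : Ideal A} {w : A}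
    (hw : w ∉ J) : ∃ I, J ≤ I ∧ I.IsSocleGenerator w := by
  obtain ⟨I, ⟨hJI, hwI⟩, hmax⟩ := WellFounded.has_min (wellFounded_gt (α := Ideal A))
    {I | J ≤ I ∧ w ∉ I} ⟨J, le_rfl, hw⟩
  refine ⟨I, hJI, hwI, fun s hs => Ideal.mem_sup_span_singleton_iff.mp ?_⟩
  by_contra h
  refine hmax _ ⟨hJI.trans le_sup_left, h⟩ (lt_of_le_of_ne le_sup_left fun h' => hs ?_)
  rw [h']
  exact Ideal.mem_sup_right (Ideal.mem_span_singleton_self s)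

variable [IsLocalRing A]

variable (A) in
theorem Ideal.isSocleGenerator_maximalIdeal : (maximalIdeal A).IsSocleGenerator 1 := by
  refine ⟨fun h => h isUnit_one, fun s hs => ?_⟩
  obtain ⟨b, hb⟩ := (IsLocalRing.notMem_maximalIdeal.mp hs).exists_left_inv
  exact ⟨b, by simp [hb]⟩

variable [IsNoetherianRing A]

theorem Ideal.mem_of_forall_mem_sup_pow {K : Ideal A} {s : A}
    (h : ∀ N, s ∈ K ⊔ maximalIdeal A ^ N) : s ∈ K := by
  rw [← Ideal.Quotient.eq_zero_iff_mem, ← Submodule.mem_bot A,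
    ← Ideal.iInf_pow_smul_eq_bot_of_isLocalRing (M := A ⧸ K) (maximalIdeal A)
      (maximalIdeal.isMaximal A).ne_top, Submodule.mem_iInf]
  intro N
  obtain ⟨k, hk, b, hb, rfl⟩ := Submodule.mem_sup.mp (h N)
  rw [map_add, Ideal.Quotient.eq_zero_iff_mem.mpr hk, zero_add]
  have := Submodule.smul_mem_smul hb
    (Submodule.mem_top (R := A) (x := (1 : A ⧸ K)))
  rwa [Algebra.smul_def, mul_one] at this

/-- Two ideals with one-dimensional socles contain a common one when the ring has a regular
sequence of length two. -/
theorem Ideal.IsSocleGenerator.exists_le_inf {x y : A}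
    (hx : ∀ s, x * s ∈ (⊥ : Ideal A) → s ∈ (⊥ : Ideal A))
    (hy : ∀ s, y * s ∈ (⊥ : Ideal A) ⊔ Ideal.span {x} → s ∈ (⊥ : Ideal A) ⊔ Ideal.span {x})
    (hxm : x ∈ maximalIdeal A) (hym : y ∈ maximalIdeal A) {I₁ I₂ : Ideal A} {t₁ t₂ : A}
    (h₁ : I₁.IsSocleGenerator t₁) (h₂ : I₂.IsSocleGenerator t₂) {M₁ M₂ : ℕ}
    (hM₁ : maximalIdeal A ^ M₁ ≤ I₁) (hM₂ : maximalIdeal A ^ M₂ ≤ I₂) :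
    ∃ (I : Ideal A) (w : A) (M : ℕ), maximalIdeal A ^ M ≤ I ∧ I.IsSocleGenerator w ∧ I ≤ I₁ ∧
      I ≤ I₂ := by
  have hxI : x ^ M₂ ∈ I₂ := hM₂ (Ideal.pow_mem_pow hxm _)
  have hyI : y ^ M₁ ∈ I₁ := hM₁ (Ideal.pow_mem_pow hym _)
  have hxa : ∀ s, x ^ M₂ * s = 0 → s = 0 := fun s hs => Ideal.mem_of_pow_mul_mem hx M₂ hs
  have hyb : ∀ s, y ^ M₁ * s ∈ Ideal.span {x ^ M₂} → s ∈ Ideal.span {x ^ M₂} := fun s hs => by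
    rw [← bot_sup_eq (Ideal.span {x ^ M₂})] at hs ⊢
    exact Ideal.mem_of_pow_mul_mem (fun s => Ideal.mem_sup_span_pow_of_mul_mem hx hy M₂) M₁ hs
  generalize x ^ M₂ = X at hxI hxa hyb
  generalize y ^ M₁ = Y at hyI hyb
  have hnot : X * t₁ ∉ Ideal.span {X} * I₁ ⊔ Ideal.span {Y} * I₂ ⊔
      Ideal.span {X * t₁ - Y * t₂} := by
    rw [Ideal.mem_sup_span_singleton_iff]
    rintro ⟨r, hr⟩
    obtain ⟨b₁, hb₁, b₂, hb₂, hsum⟩ := Submodule.mem_sup.mp hr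
    obtain ⟨i₁, hi₁, rfl⟩ := Ideal.mem_span_singleton_mul.mp hb₁
    obtain ⟨i₂, hi₂, rfl⟩ := Ideal.mem_span_singleton_mul.mp hb₂
    have h3 : i₂ - r * t₂ ∈ Ideal.span {X} := hyb _ (Ideal.mem_span_singleton'.mpr
      ⟨t₁ - i₁ - r * t₁, by linear_combination - hsum⟩)
    obtain ⟨w, hw⟩ := Ideal.mem_span_singleton'.mp h3
    have h4 : t₁ - i₁ - r * t₁ - Y * w = 0 := hxa _ (by linear_combination - hsum - Y * hw)
    rcases IsLocalRing.isUnit_or_isUnit_one_sub_self r with hu | hu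
    · refine h₂.1 ((Ideal.unit_mul_mem_iff_mem I₂ hu).mp ?_)
      have : r * t₂ = i₂ - w * X := by linear_combination hw
      rw [this]
      exact sub_mem hi₂ (Ideal.mul_mem_left _ _ hxI)
    · refine h₁.1 ((Ideal.unit_mul_mem_iff_mem I₁ hu).mp ?_)
      have : (1 - r) * t₁ = i₁ + w * Y := by linear_combination h4
      rw [this]
      exact add_mem hi₁ (Ideal.mul_mem_left _ _ hyI)
  obtain ⟨M, hM⟩ := not_forall.mp (mt Ideal.mem_of_forall_mem_sup_pow hnot)
  obtain ⟨I, hle, hI⟩ := Ideal.exists_isSocleGenerator_of_notMem hM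
  have hcolon : ∀ {I' : Ideal A} {t Z : A}, I'.IsSocleGenerator t → Ideal.span {Z} * I' ≤ I →
      Z * t ∉ I → I ≤ I' := fun {I' t Z} h' hZ ht => by
    have := h'.le_of_notMem (K := I.colon {Z})
      (fun a ha => Submodule.mem_colon_singleton.mpr
        (by rw [smul_eq_mul, mul_comm]
            exact hZ (Ideal.mul_mem_mul (Ideal.mem_span_singleton_self Z) ha)))
      (fun h => ht (by rw [mul_comm]; exact Submodule.mem_colon_singleton.mp h))
    exact fun a ha => this (Submodule.mem_colon_singleton.mpr (Ideal.mul_mem_right _ _ ha))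
  refine ⟨I, X * t₁, M, le_sup_right.trans hle, hI, hcolon h₁ ?_ hI.1, hcolon (Z := Y) h₂ ?_ fun h => ?_⟩
  · exact le_sup_left.trans (le_sup_left.trans (le_sup_left.trans hle))
  · exact le_sup_right.trans (le_sup_left.trans (le_sup_left.trans hle))
  · refine hI.1 ?_
    have := add_mem h (hle (Ideal.mem_sup_left (Ideal.mem_sup_right
      (Ideal.mem_span_singleton_self (X * t₁ - Y * t₂)))))
    rwa [add_sub_cancel] at this

theorem Ideal.exists_isSocleGenerator_le_of_regular_pair {x y : A}
    (hx : ∀ s, x * s ∈ (⊥ : Ideal A) → s ∈ (⊥ : Ideal A))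
    (hy : ∀ s, y * s ∈ (⊥ : Ideal A) ⊔ Ideal.span {x} → s ∈ (⊥ : Ideal A) ⊔ Ideal.span {x})
    (hxm : x ∈ maximalIdeal A) (hym : y ∈ maximalIdeal A) (N : ℕ) :
    ∃ (I : Ideal A) (u : A) (M : ℕ), maximalIdeal A ^ M ≤ I ∧ I.IsSocleGenerator u ∧
      I ≤ maximalIdeal A ^ N := by
  obtain ⟨s, hs, hirr⟩ := exists_infIrred_decomposition (maximalIdeal A ^ N)
  have hsN : ∀ b ∈ s, maximalIdeal A ^ N ≤ b := fun b hb => hs ▸ Finset.inf_le hb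
  rw [← hs]
  clear hs
  induction s using Finset.induction_on with
  | empty => exact ⟨maximalIdeal A, 1, 1, by simp, Ideal.isSocleGenerator_maximalIdeal A, by simp⟩
  | insert b s _ ih =>
    obtain ⟨I, u, M, hM, hu, hI⟩ := ih (fun c hc => hirr (Finset.mem_insert_of_mem hc))
      (fun c hc => hsN c (Finset.mem_insert_of_mem hc))
    have hb := hsN b (Finset.mem_insert_self b s)
    obtain ⟨t, ht⟩ := (Ideal.IsIrreducible.of_infIrred
      (hirr (Finset.mem_insert_self b s))).exists_isSocleGenerator hb
    obtain ⟨I', w, M', hM', hw, hIb, hII⟩ := ht.exists_le_inf hx hy hxm hym hu hb hM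
    exact ⟨I', w, M', hM', hw, by rw [Finset.inf_insert]; exact le_inf hIb (hII.trans hI)⟩

theorem IsWeaklyFRegular.exists_maximalIdeal_eq_span_singleton {p : ℕ} (hA : IsWeaklyFRegular A p)
    {x : A} (hx : ∀ s, x * s = 0 → s = 0) (hxm : x ∈ maximalIdeal A)
    (hrad : maximalIdeal A ≤ (Ideal.span {x}).radical) :
    ∃ z, maximalIdeal A = Ideal.span {z} ∧ ∀ s, z * s = 0 → s = 0 := by
  obtain ⟨M, hM⟩ := Ideal.exists_pow_le_of_le_radical_of_fg hrad (IsNoetherian.noetherian _)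
  have hne : ¬ ⊤ ≤ Ideal.span {x} := fun h =>
    (maximalIdeal.isMaximal A).ne_top (top_le_iff.mp
      (h.trans ((Ideal.span_singleton_le_iff_mem _).mpr hxm)))
  obtain ⟨y, -, hyx, hy⟩ := Ideal.exists_notMem_forall_mul_mem hne hM
  obtain ⟨z, hz, hyz⟩ : ∃ z ∈ maximalIdeal A, z * y ∉ Ideal.span {x} * maximalIdeal A := by
    by_contra! hcon
    have hpow : ∀ k : ℕ, ∀ a ∈ maximalIdeal A, ∃ b ∈ maximalIdeal A, a * y ^ k = x ^ k * b := by
      intro k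
      induction k with
      | zero => exact fun a ha => ⟨a, ha, by simp⟩
      | succ k ih =>
        intro a ha
        obtain ⟨b, hb, hab⟩ := ih a ha
        obtain ⟨d, hd, hbd⟩ := Ideal.mem_span_singleton_mul.mp (hcon b hb)
        exact ⟨d, hd, by linear_combination y * hab - x ^ k * hbd⟩
    refine hyx (hA _ y ⟨x, fun P hP hxP => ?_, 0, fun e _ => ?_⟩)
    · exact notMem_nonZeroDivisors_of_mem_mem_minimalPrimes hxP hP
        (mem_nonZeroDivisors_iff.mpr ⟨hx, fun s hs => hx s (by rwa [mul_comm])⟩)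
    · obtain ⟨b, -, hb⟩ := hpow (p ^ e) x hxm
      rw [hb]
      exact Ideal.mul_mem_right _ _ (Ideal.pow_mem_frobPow (Ideal.mem_span_singleton_self x) _)
  obtain ⟨d, hd⟩ := Ideal.mem_span_singleton'.mp (hy z hz)
  have hdu : IsUnit d := IsLocalRing.notMem_maximalIdeal.mp fun h =>
    hyz (Ideal.mem_span_singleton_mul.mpr ⟨d, h, by rw [mul_comm, hd]⟩)
  refine ⟨z, le_antisymm (fun a ha => ?_) ((Ideal.span_singleton_le_iff_mem _).mpr hz),
    fun s hs => ?_⟩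
  · obtain ⟨e, he⟩ := Ideal.mem_span_singleton'.mp (hy a ha)
    refine (Ideal.unit_mul_mem_iff_mem _ hdu).mp (Ideal.mem_span_singleton'.mpr ⟨e, ?_⟩)
    have := hx (e * z - d * a) (by linear_combination z * he - a * hd)
    linear_combination this
  · exact (hdu.mul_right_eq_zero).mp (hx _ (by linear_combination s * hd + y * hs))

/-- A weakly F-regular Cohen-Macaulay local ring is approximately Gorenstein. -/
theorem IsWeaklyFRegular.exists_isSocleGenerator_le {p : ℕ} (hp : 1 < p) (hA : IsWeaklyFRegular A p)
    (hCM : IsCohenMacaulayLocalRing A) (N : ℕ) :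
    ∃ (I : Ideal A) (u : A) (M : ℕ), maximalIdeal A ^ M ≤ I ∧ I.IsSocleGenerator u ∧
      I ≤ maximalIdeal A ^ N := by
  obtain ⟨n, x, ⟨-, hxm, hrad⟩, hreg⟩ := hCM
  rw [← Ideal.ofList_ofFn] at hrad
  have hxs : ∀ a ∈ List.ofFn x, a ∈ maximalIdeal A := by
    simpa [List.mem_ofFn] using hxm
  have hreg' := Ideal.RegularMod.of_isWeaklyRegular hreg.toIsWeaklyRegular
  generalize List.ofFn x = xs at hrad hxs hreg'
  match xs with
  | [] =>
    have hbot : maximalIdeal A = ⊥ := by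
      refine eq_bot_iff.mpr fun a ha => hA _ a ?_
      obtain ⟨k, hk⟩ := hrad ha
      rw [Ideal.ofList_nil] at hk
      refine ⟨1, one_mem_circComplement, k, fun e he => ?_⟩
      rw [pow_eq_zero_of_le (he.trans (Nat.lt_pow_self hp).le) hk, mul_zero]
      exact zero_mem _
    exact ⟨⊥, 1, 1, by simp [hbot], hbot ▸ Ideal.isSocleGenerator_maximalIdeal A, bot_le⟩
  | [x] =>
    obtain ⟨z, hz, hzr⟩ := hA.exists_maximalIdeal_eq_span_singleton hreg'.1 (hxs x (by simp))
      (by simpa using hrad)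
    have h1 : ((⊥ : Ideal A) ⊔ Ideal.span {z}).IsSocleGenerator 1 := by
      rw [bot_sup_eq, ← hz]
      exact Ideal.isSocleGenerator_maximalIdeal A
    have h2 := h1.sup_span_pow hzr N
    rw [bot_sup_eq, ← Ideal.span_singleton_pow, ← hz] at h2
    exact ⟨_, _, N + 1, le_rfl, h2, Ideal.pow_le_pow_right N.le_succ⟩
  | x :: y :: _ =>
    exact Ideal.exists_isSocleGenerator_le_of_regular_pair hreg'.1 hreg'.2.1
      (hxs x (by simp)) (hxs y (by simp)) N

end ApproximatelyGorenstein

section Main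

theorem Ideal.IsSocleGenerator.comap {A B : Type*} [CommRing A] [CommRing B] {f : A →+* B}
    (hf : Function.Surjective f) {J : Ideal B} {v : A} (hv : J.IsSocleGenerator (f v)) :
    (J.comap f).IsSocleGenerator v := by
  refine ⟨hv.1, fun s hs => ?_⟩
  obtain ⟨b, hb⟩ := hv.2 _ hs
  obtain ⟨a, rfl⟩ := hf b
  exact ⟨a, by rwa [Ideal.mem_comap, map_sub, map_mul]⟩

theorem Ideal.comap_ofList_map {A B : Type*} [CommRing A] [CommRing B] {f : A →+* B}
    (hf : Function.Surjective f) (zs : List A) :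
    (Ideal.ofList (zs.map f)).comap f = RingHom.ker f ⊔ Ideal.ofList zs := by
  rw [← Ideal.map_ofList, Ideal.comap_map_of_surjective' f hf, sup_comm]

theorem IsSystemOfParameters.pow {A : Type*} [CommRing A] [IsLocalRing A] {n : ℕ} {x : Fin n → A}
    (hx : IsSystemOfParameters A x) (k : ℕ) :
    IsSystemOfParameters A fun i => x i ^ (k + 1) := by
  refine ⟨hx.1, fun i => Ideal.pow_mem_of_mem _ (hx.2.1 i) _ k.succ_pos, hx.2.2.trans ?_⟩
  rw [← Ideal.radical_idem (Ideal.span (Set.range fun i => x i ^ (k + 1)))]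
  refine Ideal.radical_mono (Ideal.span_le.mpr ?_)
  rintro _ ⟨i, rfl⟩
  exact ⟨k + 1, Ideal.subset_span ⟨i, rfl⟩⟩

theorem IsSystemOfParameters.isParameterIdeal {A : Type*} [CommRing A] [IsLocalRing A] {n : ℕ}
    {x : Fin n → A} (hx : IsSystemOfParameters A x) :
    (Ideal.span (Set.range x)).IsParameterIdeal :=
  ⟨n, n, le_rfl, x, hx, rfl⟩

/-- A ring is weakly F-regular once arbitrarily small primary ideals with one-dimensional socles
are tightly closed. -/
theorem isWeaklyFRegular_of_isSocleGenerator {A : Type*} [CommRing A] [IsLocalRing A]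
    [IsNoetherianRing A] {p : ℕ}
    (h : ∀ N, ∃ (J : Ideal A) (w : A) (M : ℕ), maximalIdeal A ^ M ≤ J ∧ J ≤ maximalIdeal A ^ N ∧
      J.IsSocleGenerator w ∧ J.IsTightlyClosed p) : IsWeaklyFRegular A p := by
  intro K s hs
  refine Ideal.mem_of_forall_mem_sup_pow fun N => ?_
  obtain ⟨J, w, M, hM, hN, hw, hJ⟩ := h N
  by_contra hsN
  obtain ⟨y, hy, hys⟩ := hw.exists_mul_notMem hM (hN.trans le_sup_right) hsN
  exact hys (hJ _ (hs.of_mul fun k hk => hy k (Ideal.mem_sup_left hk)))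

variable {R S : Type*} [CommRing R] [CommRing S] [Algebra R S] [IsLocalRing R]

theorem isTightlyClosed_map_sup_ofList {p : ℕ} [ExpChar R p] [ExpChar S p] [IsNoetherianRing R]
    (hR : IsWeaklyFRegular R p) {c : S} (hc : IsTestElement p c) {ws : List S}
    (hflat : ∀ e, Ideal.ColonFlat R (Ideal.ofList (ws.map (· ^ p ^ e))))
    (hfib : ∀ v, (∀ e, c * v ^ p ^ e ∈
        (maximalIdeal R).map (algebraMap R S) ⊔ Ideal.ofList (ws.map (· ^ p ^ e))) →
      v ∈ (maximalIdeal R).map (algebraMap R S) ⊔ Ideal.ofList ws)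
    {I : Ideal R} {u : R} {v : S} {M : ℕ} (hM : maximalIdeal R ^ M ≤ I) (hu : I.IsSocleGenerator u)
    (hv : ((maximalIdeal R).map (algebraMap R S) ⊔ Ideal.ofList ws).IsSocleGenerator v) :
    (I.map (algebraMap R S) ⊔ Ideal.ofList ws).IsTightlyClosed p := by
  intro s hs
  by_contra hsJ
  have hflat0 : Ideal.ColonFlat R (Ideal.ofList ws) := by simpa using hflat 0
  obtain ⟨a, ha⟩ := (hflat0.isSocleGenerator_mul hM hu hv).2 s hsJ
  refine hv.1 (hfib v fun e => ?_)
  have h1 := hc.2 _ _ (hs.of_sub_mul_mem p ha) e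
  rw [Ideal.frobPow_map_sup_ofList p, mul_pow, mul_left_comm, ← map_pow] at h1
  obtain ⟨N, hN⟩ := Ideal.exists_pow_le_frobPow hM (p ^ e)
  have hcolon : ((I.frobPow (p ^ e)).colon {u ^ p ^ e} : Ideal R) ≤ maximalIdeal R :=
    Ideal.colon_le_maximalIdeal (hR.pow_notMem_frobPow hu.1 e)
  exact sup_le_sup_right (Ideal.map_mono hcolon) (Ideal.ofList (ws.map (· ^ p ^ e)))
    (hflat e _ N hN _ _ h1)

end Main

/-- **Theorem 3.4(2)** (Aberbach). Let `φ : (R,m) → (S,n)` be a flat local homomorphism of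
Noetherian local rings of prime characteristic `p` with Gorenstein closed fiber `S/mS`.
If `R` is weakly F-regular and Cohen-Macaulay, some `c ∈ S − mS` is a test element for `S`,
and `S/mS` is F-rational, then `S` is weakly F-regular. -/
theorem weaklyFRegular_of_flat_of_gorenstein_fiber_of_test_element_outside
    (p : ℕ) [Fact p.Prime]
    (R S : Type*) [CommRing R] [CommRing S]
    [IsNoetherianRing R] [IsNoetherianRing S]
    [IsLocalRing R] [IsLocalRing S] [CharP R p] [CharP S p]
    [Algebra R S] [Module.Flat R S] [IsLocalHom (algebraMap R S)]
    [IsLocalRing (S ⧸ Ideal.map (algebraMap R S) (IsLocalRing.maximalIdeal R))]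
    (hGor : IsGorensteinLocalRing (S ⧸ Ideal.map (algebraMap R S) (IsLocalRing.maximalIdeal R)))
    (hWFR : IsWeaklyFRegular R p) (hCM : IsCohenMacaulayLocalRing R)
    (c : S) (hc : c ∉ Ideal.map (algebraMap R S) (IsLocalRing.maximalIdeal R))
    (hcS : IsTestElement p c)
    (hFrat : IsFRational (S ⧸ Ideal.map (algebraMap R S) (IsLocalRing.maximalIdeal R)) p) :
    IsWeaklyFRegular S p := by
  have hp : p.Prime := Fact.out
  have hmn : (maximalIdeal R).map (algebraMap R S) ≤ maximalIdeal S :=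
    IsLocalRing.map_maximalIdeal_le _
  let T := S ⧸ (maximalIdeal R).map (algebraMap R S)
  let π : S →+* T := Ideal.Quotient.mk _
  have hπ : Function.Surjective π := Ideal.Quotient.mk_surjective
  have hker : RingHom.ker π = (maximalIdeal R).map (algebraMap R S) := Ideal.mk_ker
  have : IsLocalHom π := .of_surjective π hπ
  have : CharP T p := (CharP.charP_iff_prime_eq_zero hp).mpr (by
    rw [← map_natCast π, CharP.cast_eq_zero, map_zero])
  obtain ⟨n, y, hy, hreg, hirr⟩ := hGor
  choose z hz using fun i => hπ (y i)
  obtain rfl : (fun i => π (z i)) = y := funext hz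
  have hlist : ∀ k, Ideal.ofList (((List.ofFn z).map (· ^ k)).map π) =
      Ideal.span (Set.range fun i => π (z i) ^ k) := fun k => by
    rw [← Ideal.ofList_ofFn, List.map_map, List.map_ofFn]
    congr 2
  have hlist1 : Ideal.ofList ((List.ofFn z).map π) =
      Ideal.span (Set.range fun i => π (z i)) := by
    rw [List.map_ofFn, Ideal.ofList_ofFn]
    rfl
  have hzs : ∀ a ∈ List.ofFn z, a ∈ maximalIdeal S := by
    simp only [List.mem_ofFn, forall_exists_index, forall_apply_eq_imp_iff]
    exact fun i h => hy.2.1 i (h.map π)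
  have hregS : ((maximalIdeal R).map (algebraMap R S)).RegularMod (List.ofFn z) := by
    rw [← hker]
    refine Ideal.RegularMod.comap hπ (L := ⊥) (.of_isWeaklyRegular ?_)
    rw [List.map_ofFn]
    exact hreg.toIsWeaklyRegular
  have hflat : ∀ k, Ideal.ColonFlat R (Ideal.ofList ((List.ofFn z).map (· ^ k))) := fun k => by
    rw [← bot_sup_eq (Ideal.ofList _)]
    exact (Ideal.colonFlat_bot R S).sup_ofList (by rw [sup_bot_eq]; exact hregS.map_pow k)
  have hcomap : ∀ zs : List S, (Ideal.ofList (zs.map π)).comap π =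
      (maximalIdeal R).map (algebraMap R S) ⊔ Ideal.ofList zs := fun zs => by
    rw [Ideal.comap_ofList_map hπ, hker]
  obtain ⟨v, hv⟩ : ∃ v, ((maximalIdeal R).map (algebraMap R S) ⊔
      Ideal.ofList (List.ofFn z)).IsSocleGenerator v := by
    obtain ⟨N, hN⟩ := Ideal.exists_pow_le_of_le_radical_of_fg hy.2.2 (IsNoetherian.noetherian _)
    obtain ⟨w, hw⟩ := hirr.exists_isSocleGenerator hN
    obtain ⟨v, rfl⟩ := hπ w
    refine ⟨v, ?_⟩
    rw [← hcomap, hlist1]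
    exact hw.comap hπ
  have hrad : maximalIdeal S ≤ ((maximalIdeal R).map (algebraMap R S) ⊔
      Ideal.ofList (List.ofFn z)).radical := by
    intro a ha
    obtain ⟨k, hk⟩ := hy.2.2 (show π a ∈ maximalIdeal T from
      fun h => ha (isUnit_of_map_unit π a h))
    refine ⟨k, ?_⟩
    rwa [← hcomap, hlist1, Ideal.mem_comap, map_pow]
  have hcT : π c ∈ circComplement T := hFrat.mem_circComplement hp.one_lt fun h =>
    hc (by rwa [← hker])
  refine isWeaklyFRegular_of_isSocleGenerator fun N => ?_
  obtain ⟨I, u, M, hM, hu, hI⟩ := hWFR.exists_isSocleGenerator_le hp.one_lt hCM N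
  obtain ⟨v', hv'⟩ := Ideal.IsSocleGenerator.exists_ofList_map_pow hregS hv N
  have hpow : ∀ e, ((List.ofFn z).map (· ^ (N + 1))).map (· ^ p ^ e) =
      (List.ofFn z).map (· ^ ((N + 1) * p ^ e)) := fun e => by
    rw [List.map_map]
    simp [Function.comp_def, pow_mul]
  have hle : maximalIdeal S ≤ (I.map (algebraMap R S) ⊔
      Ideal.ofList ((List.ofFn z).map (· ^ (N + 1)))).radical := by
    rw [← Ideal.radical_idem (I.map (algebraMap R S) ⊔ _)]
    refine hrad.trans (Ideal.radical_mono (sup_le ?_ (Ideal.span_le.mpr fun a ha => ?_)))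
    · rw [Ideal.map_le_iff_le_comap]
      refine fun a ha => ⟨M, Ideal.mem_sup_left ?_⟩
      rw [← map_pow]
      exact Ideal.mem_map_of_mem _ (hM (Ideal.pow_mem_pow ha M))
    · exact ⟨N + 1, Ideal.mem_sup_right (Ideal.subset_span (List.mem_map_of_mem ha))⟩
  obtain ⟨M', hM'⟩ := Ideal.exists_pow_le_of_le_radical_of_fg hle (IsNoetherian.noetherian _)
  refine ⟨_, _, M', hM', sup_le ?_ (Ideal.span_le.mpr fun a ha => ?_),
    (hflat (N + 1)).isSocleGenerator_mul hM hu hv',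
    isTightlyClosed_map_sup_ofList hWFR hcS (fun e => by rw [hpow]; exact hflat _)
      (fun w hw => ?_) hM hu hv'⟩
  · refine (Ideal.map_mono hI).trans ?_
    rw [Ideal.map_pow]
    exact Ideal.pow_right_mono hmn N
  · obtain ⟨b, hb, rfl⟩ := List.mem_map.mp ha
    exact Ideal.pow_le_pow_right N.le_succ (Ideal.pow_mem_pow (hzs b hb) _)
  · rw [← hcomap, hlist, Ideal.mem_comap]
    refine hFrat _ (hy.pow N).isParameterIdeal _ ⟨π c, hcT, 0, fun e _ => ?_⟩
    have h1 := hw e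
    rw [← hcomap, Ideal.mem_comap, map_mul, map_pow, hpow, hlist] at h1
    refine (Ideal.span_le.mpr ?_ : _ ≤ _) h1
    rintro _ ⟨i, rfl⟩
    simp only [pow_mul]
    exact Ideal.pow_mem_frobPow (Ideal.subset_span (Set.mem_range_self i)) _
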